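/- arXiv:0807.3313 — 2 statements merged into one kernel-verified Lean document; each statement's English description precedes it below -/
import Mathlib

section
/- For all 0 < s < t, κ₂ > 0 and all reals q, r, the following Gaussian integral identity holds: ∫_{−∞}^{∞} [ Φ_{κ₂s}(q−x)·(1 − Φ_{κ₂t}(r−x)) − ∫_{−∞}^{q−x} φ_{κ₂s}(u)·(1 − Φ_{κ₂(t−s)}(r−x−u)) du ] dx = Ψ_{κ₂(t+s)}(|q−r|) − Ψ_{κ₂(t−s)}(|q−r|). (The inner integral is the joint probability P(B(κ₂s) ≤ q−x, B(κ₂t) > r−x) for a standard Brownian motion B; in the notation of the paper this says Γ_q^{(1)}((s,q),(t,r)) = Γ_q((s,q),(t,r)).) -/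
open MeasureTheory Real Set

/-- The centered Gaussian density with variance `s`. -/
noncomputable def gphi (s x : ℝ) : ℝ :=
  (Real.sqrt (2 * Real.pi * s))⁻¹ * Real.exp (-(x ^ 2) / (2 * s))

/-- The centered Gaussian distribution function with variance `s`. -/
noncomputable def gPhi (s x : ℝ) : ℝ := ∫ y in Set.Iic x, gphi s y

/-- `Ψ_{σ²}(x) = σ²·φ_{σ²}(x) − x·(1 − Φ_{σ²}(x))`. -/
noncomputable def gPsi (s x : ℝ) : ℝ := s * gphi s x - x * (1 - gPhi s x)

open ProbabilityTheory
open scoped NNReal ENNReal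

lemma gphi_eq_gaussianPDFReal (v : ℝ≥0) (x : ℝ) : gphi v x = gaussianPDFReal 0 v x := by
  simp [gphi, gaussianPDFReal]

lemma gPhi_eq_measureReal_Iic {v : ℝ≥0} (hv : v ≠ 0) (x : ℝ) :
    gPhi v x = (gaussianReal 0 v).real (Iic x) := by
  rw [measureReal_def, gaussianReal_apply_eq_integral 0 hv, ENNReal.toReal_ofReal
    (integral_nonneg fun y => gaussianPDFReal_nonneg 0 v y)]
  simp only [gPhi, gphi_eq_gaussianPDFReal]

lemma one_sub_gPhi_eq_measureReal_Ioi {v : ℝ≥0} (hv : v ≠ 0) (x : ℝ) :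
    1 - gPhi v x = (gaussianReal 0 v).real (Ioi x) := by
  rw [gPhi_eq_measureReal_Iic hv, ← probReal_compl_eq_one_sub measurableSet_Iic, compl_Iic]

lemma gphi_neg (v x : ℝ) : gphi v (-x) = gphi v x := by
  simp [gphi]

lemma gPhi_neg {v : ℝ≥0} (hv : v ≠ 0) (x : ℝ) : gPhi v (-x) = 1 - gPhi v x := by
  have h := integral_comp_neg_Ioi x (gphi v)
  simp only [gphi_neg] at h
  rw [one_sub_gPhi_eq_measureReal_Ioi hv, measureReal_def, gaussianReal_apply_eq_integral 0 hv,
    ENNReal.toReal_ofReal (integral_nonneg fun y => gaussianPDFReal_nonneg 0 v y)]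
  simp only [← gphi_eq_gaussianPDFReal, h, gPhi]

lemma gPsi_neg {v : ℝ≥0} (hv : v ≠ 0) (x : ℝ) : gPsi v (-x) = gPsi v x + x := by
  rw [gPsi, gPsi, gphi_neg, gPhi_neg hv]
  ring

lemma gPsi_neg_eq_gPsi_abs_add {v : ℝ≥0} (hv : v ≠ 0) (x : ℝ) :
    gPsi v (-x) = gPsi v |x| + max x 0 := by
  rcases le_total 0 x with hx | hx
  · rw [abs_of_nonneg hx, max_eq_left hx, gPsi_neg hv]
  · rw [abs_of_nonpos hx, max_eq_right hx, add_zero]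

lemma hasDerivAt_gphi {v : ℝ} (hv : v ≠ 0) (x : ℝ) :
    HasDerivAt (fun y => -(v * gphi v y)) (x * gphi v x) x := by
  have h : HasDerivAt (fun y : ℝ => -(y ^ 2) / (2 * v)) (-(2 * x) / (2 * v)) x := by
    simpa using ((hasDerivAt_pow 2 x).neg.div_const (2 * v))
  convert! ((h.exp.const_mul (√(2 * π * v))⁻¹).const_mul v).neg using 1
  simp only [gphi]
  field_simp

lemma integrable_id_gaussianReal (v : ℝ≥0) : Integrable (fun x => x) (gaussianReal 0 v) :=
  memLp_one_iff_integrable.mp (memLp_id_gaussianReal 1)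

lemma integrable_mul_gphi {v : ℝ≥0} (hv : v ≠ 0) : Integrable fun x => x * gphi v x := by
  have h := integrable_id_gaussianReal v
  rw [gaussianReal_of_var_ne_zero 0 hv,
    integrable_withDensity_iff (measurable_gaussianPDF 0 v) (by simp [gaussianPDF_lt_top])] at h
  simpa only [toReal_gaussianPDF, ← gphi_eq_gaussianPDFReal] using h

lemma tendsto_gphi_atTop {v : ℝ} (hv : 0 < v) :
    Filter.Tendsto (gphi v) Filter.atTop (nhds 0) := by
  have h : Filter.Tendsto (fun x : ℝ => -(x ^ 2) / (2 * v)) Filter.atTop Filter.atBot := by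
    simp only [neg_div]
    exact Filter.tendsto_neg_atTop_atBot.comp
      ((Filter.tendsto_pow_atTop two_ne_zero).atTop_div_const (by positivity))
  have := (tendsto_exp_atBot.comp h).const_mul (√(2 * π * v))⁻¹
  rwa [mul_zero] at this

lemma setIntegral_Ioi_mul_gphi {v : ℝ≥0} (hv : v ≠ 0) (x : ℝ) :
    ∫ z in Ioi x, z * gphi v z = v * gphi v x := by
  have hv' : (0 : ℝ) < v := by positivity
  rw [integral_Ioi_of_hasDerivAt_of_tendsto' (fun z _ => hasDerivAt_gphi hv'.ne' z)
    (integrable_mul_gphi hv).integrableOn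
    (by simpa using ((tendsto_gphi_atTop hv').const_mul (v : ℝ)).neg)]
  ring

lemma integral_posPart_gaussianReal {v : ℝ≥0} (hv : v ≠ 0) (d : ℝ) :
    ∫ z, max (d + z) 0 ∂gaussianReal 0 v = gPsi v (-d) := by
  have hint : Integrable (gphi v) := by
    rw [funext (gphi_eq_gaussianPDFReal v)]
    exact integrable_gaussianPDFReal 0 v
  have hmass : ∫ z in Ioi (-d), gphi v z = 1 - gPhi v (-d) := by
    rw [one_sub_gPhi_eq_measureReal_Ioi hv, measureReal_def, gaussianReal_apply_eq_integral 0 hv,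
      ENNReal.toReal_ofReal (integral_nonneg fun y => gaussianPDFReal_nonneg 0 v y)]
    simp only [gphi_eq_gaussianPDFReal]
  calc ∫ z, max (d + z) 0 ∂gaussianReal 0 v
      = ∫ z, (Ioi (-d)).indicator (fun z => d * gphi v z + z * gphi v z) z := by
        rw [integral_gaussianReal_eq_integral_smul hv]
        congr 1 with z
        rw [← gphi_eq_gaussianPDFReal, smul_eq_mul, indicator_apply]
        split_ifs with h
        · rw [max_eq_left (by linarith [mem_Ioi.mp h])]
          ring
        · rw [max_eq_right (by linarith [notMem_Ioi.mp h]), mul_zero]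
    _ = gPsi v (-d) := by
        rw [integral_indicator measurableSet_Ioi, integral_add (hint.const_mul d).integrableOn
          (integrable_mul_gphi hv).integrableOn, integral_const_mul, hmass,
          setIntegral_Ioi_mul_gphi hv, gPsi]
        ring

lemma measurableSet_le_and_lt {α : Type*} [MeasurableSpace α] {f g h k : α → ℝ}
    (hf : Measurable f) (hg : Measurable g) (hh : Measurable h) (hk : Measurable k) :
    MeasurableSet {x | f x ≤ g x ∧ h x < k x} := by
  rw [ofPred_and]
  exact (measurableSet_le hf hg).inter (measurableSet_lt hh hk)

section

variable {Ω : Type*} [MeasurableSpace Ω] {P : Measure Ω} [IsFiniteMeasure P] {U W : Ω → ℝ}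

lemma lintegral_measure_le_sub_lt (hU : Measurable U) (hW : Measurable W) (q r : ℝ) :
    ∫⁻ x, P {ω | U ω ≤ q - x ∧ r - x < W ω} = ∫⁻ ω, ENNReal.ofReal (q - r + (W ω - U ω)) ∂P := by
  have hS : MeasurableSet {p : ℝ × Ω | U p.2 ≤ q - p.1 ∧ r - p.1 < W p.2} :=
    measurableSet_le_and_lt (by fun_prop) (by fun_prop) (by fun_prop) (by fun_prop)
  have h := (Measure.prod_apply (μ := volume) (ν := P) hS).symm.trans (Measure.prod_apply_symm hS)
  refine h.trans (lintegral_congr fun ω => ?_)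
  have : (fun x => (x, ω)) ⁻¹' {p : ℝ × Ω | U p.2 ≤ q - p.1 ∧ r - p.1 < W p.2}
      = Ioc (r - W ω) (q - U ω) := by
    ext x
    simp only [mem_preimage, mem_ofPred_eq, mem_Ioc]
    constructor <;> rintro ⟨h₁, h₂⟩ <;> constructor <;> linarith
  rw [this, Real.volume_Ioc]
  congr 1
  ring

lemma measurable_measure_le_sub_lt (hU : Measurable U) (hW : Measurable W) (q r : ℝ) :
    Measurable fun x => P {ω | U ω ≤ q - x ∧ r - x < W ω} :=
  measurable_measure_prodMk_left (s := {p : ℝ × Ω | U p.2 ≤ q - p.1 ∧ r - p.1 < W p.2})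
    (measurableSet_le_and_lt (by fun_prop) (by fun_prop) (by fun_prop) (by fun_prop))

lemma lintegral_measure_le_sub_lt_ne_top (hU : Measurable U) (hW : Measurable W)
    (hi : Integrable (fun ω => W ω - U ω) P) (q r : ℝ) :
    ∫⁻ x, P {ω | U ω ≤ q - x ∧ r - x < W ω} ≠ ∞ := by
  rw [lintegral_measure_le_sub_lt hU hW]
  exact ((integrable_const (q - r)).add hi).lintegral_lt_top.ne

lemma integrable_measureReal_le_sub_lt (hU : Measurable U) (hW : Measurable W)
    (hi : Integrable (fun ω => W ω - U ω) P) (q r : ℝ) :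
    Integrable fun x => P.real {ω | U ω ≤ q - x ∧ r - x < W ω} :=
  integrable_toReal_of_lintegral_ne_top (measurable_measure_le_sub_lt hU hW q r).aemeasurable
    (lintegral_measure_le_sub_lt_ne_top hU hW hi q r)

lemma integral_measureReal_le_sub_lt (hU : Measurable U) (hW : Measurable W) (q r : ℝ) :
    ∫ x, P.real {ω | U ω ≤ q - x ∧ r - x < W ω} = ∫ ω, max (q - r + (W ω - U ω)) 0 ∂P := by
  simp only [measureReal_def]
  rw [integral_toReal (measurable_measure_le_sub_lt hU hW q r).aemeasurable
      (by simp [measure_lt_top]), lintegral_measure_le_sub_lt hU hW,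
    integral_eq_lintegral_of_nonneg_ae (by filter_upwards with ω using le_max_right _ _)
      (by fun_prop)]
  simp [ENNReal.ofReal_max]

lemma integral_measureReal_le_sub_lt_of_hasLaw (hU : Measurable U) (hW : Measurable W)
    {v : ℝ≥0} (hv : v ≠ 0) (h : HasLaw (fun ω => W ω - U ω) (gaussianReal 0 v) P) (q r : ℝ) :
    ∫ x, P.real {ω | U ω ≤ q - x ∧ r - x < W ω} = gPsi v (-(q - r)) := by
  rw [integral_measureReal_le_sub_lt hU hW, ← integral_posPart_gaussianReal hv, ← h.map_eq,
    integral_map h.aemeasurable (by fun_prop)]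

end

lemma hasLaw_snd_sub_fst (a c : ℝ≥0) :
    HasLaw (fun p : ℝ × ℝ => p.2 - p.1) (gaussianReal 0 (a + c))
      ((gaussianReal 0 a).prod (gaussianReal 0 c)) where
  map_eq := by
    have hX : ((gaussianReal 0 a).prod (gaussianReal 0 c)).map (fun p : ℝ × ℝ => -p.1)
        = gaussianReal 0 a := by
      rw [show (fun p : ℝ × ℝ => -p.1) = Neg.neg ∘ Prod.fst from rfl,
        ← Measure.map_map measurable_neg measurable_fst, Measure.map_fst_prod]
      simpa using gaussianReal_map_neg (μ := 0) (v := a)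
    have hY : ((gaussianReal 0 a).prod (gaussianReal 0 c)).map (fun p : ℝ × ℝ => p.2)
        = gaussianReal 0 c := by
      simp
    have h := gaussianReal_add_gaussianReal_of_indepFun
      (indepFun_prod (X := fun x : ℝ => -x) (Y := fun x : ℝ => x) measurable_neg measurable_id)
      hX hY
    rw [add_zero] at h
    rw [← h]
    congr 1 with p
    simp [sub_eq_neg_add]

lemma hasLaw_fst_add_snd_sub_fst (a b : ℝ≥0) :
    HasLaw (fun p : ℝ × ℝ => p.1 + p.2 - p.1) (gaussianReal 0 b)
      ((gaussianReal 0 a).prod (gaussianReal 0 b)) where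
  map_eq := by
    simp only [add_sub_cancel_left]
    simp

lemma integrable_of_hasLaw_gaussianReal {Ω : Type*} [MeasurableSpace Ω] {P : Measure Ω}
    {X : Ω → ℝ} {v : ℝ≥0} (h : HasLaw X (gaussianReal 0 v) P) : Integrable X P := by
  have := integrable_id_gaussianReal v
  rw [← h.map_eq] at this
  exact this.comp_aemeasurable h.aemeasurable

lemma gPhi_mul_one_sub_gPhi {a c : ℝ≥0} (ha : a ≠ 0) (hc : c ≠ 0) (y z : ℝ) :
    gPhi a y * (1 - gPhi c z)
      = ((gaussianReal 0 a).prod (gaussianReal 0 c)).real {p | p.1 ≤ y ∧ z < p.2} := by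
  rw [one_sub_gPhi_eq_measureReal_Ioi hc, gPhi_eq_measureReal_Iic ha, ← measureReal_prod_prod]
  rfl

lemma setIntegral_Iic_gphi_mul_one_sub_gPhi {a b : ℝ≥0} (ha : a ≠ 0) (hb : b ≠ 0) (y z : ℝ) :
    ∫ u in Iic y, gphi a u * (1 - gPhi b (z - u))
      = ((gaussianReal 0 a).prod (gaussianReal 0 b)).real {p | p.1 ≤ y ∧ z < p.1 + p.2} := by
  have hS : MeasurableSet {p : ℝ × ℝ | p.1 ≤ y ∧ z < p.1 + p.2} :=
    measurableSet_le_and_lt (by fun_prop) (by fun_prop) (by fun_prop) (by fun_prop)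
  rw [measureReal_def, Measure.prod_apply hS,
    ← integral_toReal (measurable_measure_prodMk_left hS).aemeasurable (by simp [measure_lt_top]),
    integral_gaussianReal_eq_integral_smul ha, ← integral_indicator measurableSet_Iic]
  congr 1 with u
  rw [← gphi_eq_gaussianPDFReal, smul_eq_mul, indicator_apply]
  split_ifs with h
  · rw [one_sub_gPhi_eq_measureReal_Ioi hb, measureReal_def]
    congr 3
    ext v
    simp [mem_Iic.mp h, sub_lt_iff_lt_add']
  · have : Prod.mk u ⁻¹' {p : ℝ × ℝ | p.1 ≤ y ∧ z < p.1 + p.2} = ∅ := by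
      ext v
      simp [mem_Iic.not.mp h]
    simp [this]

/-- the Gaussian integral identity `Γ_q^{(1)}((s,q),(t,r)) = Γ_q((s,q),(t,r))`
for `0 < s < t`. -/
theorem gammaq_identity (κ₂ s t q r : ℝ) (hκ : 0 < κ₂) (hs : 0 < s) (hst : s < t) :
    (∫ x : ℝ, (gPhi (κ₂ * s) (q - x) * (1 - gPhi (κ₂ * t) (r - x))
        - ∫ u in Set.Iic (q - x), gphi (κ₂ * s) u * (1 - gPhi (κ₂ * (t - s)) (r - x - u))))
    = gPsi (κ₂ * (t + s)) |q - r| - gPsi (κ₂ * (t - s)) |q - r| := by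
  obtain ⟨a, ha⟩ : ∃ a : ℝ≥0, (a : ℝ) = κ₂ * s := ⟨⟨κ₂ * s, by positivity⟩, rfl⟩
  obtain ⟨b, hb⟩ : ∃ b : ℝ≥0, (b : ℝ) = κ₂ * (t - s) :=
    ⟨⟨κ₂ * (t - s), mul_nonneg hκ.le (sub_nonneg.mpr hst.le)⟩, rfl⟩
  have ha0 : a ≠ 0 := by
    rw [← NNReal.coe_ne_zero, ha]
    positivity
  have hb0 : b ≠ 0 := by
    rw [← NNReal.coe_ne_zero, hb]
    exact (mul_pos hκ (sub_pos.mpr hst)).ne'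
  have hab0 : a + b ≠ 0 := by positivity
  have haab0 : a + (a + b) ≠ 0 := by positivity
  have ht : κ₂ * t = ((a + b : ℝ≥0) : ℝ) := by
    push_cast
    linear_combination -ha - hb
  have hts : κ₂ * (t + s) = ((a + (a + b) : ℝ≥0) : ℝ) := by
    push_cast
    linear_combination -2 * ha - hb
  have hindep := hasLaw_snd_sub_fst a (a + b)
  have hjoint := hasLaw_fst_add_snd_sub_fst a b
  have hadd : Measurable fun p : ℝ × ℝ => p.1 + p.2 := measurable_fst.add measurable_snd
  rw [hts, ht, ← ha, ← hb]
  simp only [gPhi_mul_one_sub_gPhi ha0 hab0, setIntegral_Iic_gphi_mul_one_sub_gPhi ha0 hb0]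
  rw [integral_sub
      (integrable_measureReal_le_sub_lt measurable_fst measurable_snd
        (integrable_of_hasLaw_gaussianReal hindep) q r)
      (integrable_measureReal_le_sub_lt measurable_fst hadd
        (integrable_of_hasLaw_gaussianReal hjoint) q r),
    integral_measureReal_le_sub_lt_of_hasLaw measurable_fst measurable_snd haab0 hindep,
    integral_measureReal_le_sub_lt_of_hasLaw measurable_fst hadd
      hb0 hjoint, gPsi_neg_eq_gPsi_abs_add haab0, gPsi_neg_eq_gPsi_abs_add hb0]
  ring
end

section
/- Under the stated assumptions on γ, the function Λ is differentiable on ℝ and for every α ∈ ℝ its derivative is Λ′(α) = ∫_0^∞ γ′(Z_α(y))·(1 − F_α(y)) dy − ∫_{−∞}^0 γ′(Z_α(y))·F_α(y) dy. -/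
open MeasureTheory Real

open ProbabilityTheory

lemma exp_neg_abs_le_mix {h : ℝ} (h0 : 0 ≤ h) (h1 : h ≤ 1) (u : ℝ) :
    exp (-|u|) ≤ 1 - h + exp u * h := by
  have hu : exp (-|u|) ≤ exp u := exp_le_exp.2 (neg_abs_le u)
  have h_one : exp (-|u|) ≤ 1 := exp_le_one_iff.2 (neg_nonpos.2 (abs_nonneg u))
  nlinarith [mul_le_mul_of_nonneg_right hu h0,
    mul_le_mul_of_nonneg_right h_one (sub_nonneg.2 h1)]

lemma mix_le_exp_abs {h : ℝ} (h0 : 0 ≤ h) (h1 : h ≤ 1) (u : ℝ) :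
    1 - h + exp u * h ≤ exp |u| := by
  have hu : exp u ≤ exp |u| := exp_le_exp.2 (le_abs_self u)
  have h_one : 1 ≤ exp |u| := one_le_exp (abs_nonneg u)
  nlinarith [mul_le_mul_of_nonneg_right hu h0,
    mul_le_mul_of_nonneg_right h_one (sub_nonneg.2 h1)]

lemma mix_pos {h : ℝ} (h0 : 0 ≤ h) (h1 : h ≤ 1) (u : ℝ) : 0 < 1 - h + exp u * h :=
  (exp_pos _).trans_le (exp_neg_abs_le_mix h0 h1 u)

lemma abs_log_mix_le {h : ℝ} (h0 : 0 ≤ h) (h1 : h ≤ 1) (u : ℝ) :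
    |log (1 - h + exp u * h)| ≤ |u| :=
  abs_le.2 ⟨(le_log_iff_exp_le (mix_pos h0 h1 u)).2 (exp_neg_abs_le_mix h0 h1 u),
    (log_le_iff_le_exp (mix_pos h0 h1 u)).2 (mix_le_exp_abs h0 h1 u)⟩

lemma exp_mul_div_mix_le {h : ℝ} (h0 : 0 ≤ h) (h1 : h ≤ 1) (u : ℝ) :
    exp u * h / (1 - h + exp u * h) ≤ exp (2 * |u|) * h := by
  rw [div_le_iff₀ (mix_pos h0 h1 u)]
  calc exp u * h ≤ exp |u| * h := by gcongr; exact le_abs_self u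
    _ = exp (2 * |u|) * h * exp (-|u|) := by
      rw [mul_right_comm, ← exp_add]; ring_nf
    _ ≤ exp (2 * |u|) * h * (1 - h + exp u * h) := by
      gcongr; exact exp_neg_abs_le_mix h0 h1 u

lemma hasDerivAt_comp_log_mix {γ : ℝ → ℝ} (hγ : Differentiable ℝ γ) {h : ℝ} (h0 : 0 ≤ h)
    (h1 : h ≤ 1) (s x : ℝ) :
    HasDerivAt (fun x => γ (log (1 - h + exp (s * x) * h)))
      (deriv γ (log (1 - h + exp (s * x) * h)) *
        (s * (exp (s * x) * h / (1 - h + exp (s * x) * h)))) x := by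
  have hw : HasDerivAt (fun x => 1 - h + exp (s * x) * h) (exp (s * x) * s * h) x := by
    have := (((hasDerivAt_id x).const_mul s).exp.mul_const h).const_add (1 - h)
    simpa using this
  exact ((hγ _).hasDerivAt.comp x (hw.log (mix_pos h0 h1 _).ne')).congr_deriv (by ring)

/-- Differentiation under the integral of `γ` evaluated at the cumulant generating functions
of `s y` times a Bernoulli variable with parameter `h y`. -/
theorem hasDerivAt_integral_comp_log_mix {γ : ℝ → ℝ} (hγ : ContDiff ℝ 1 γ) (hγ0 : γ 0 = 0)
    {h s : ℝ → ℝ} (hh : Integrable h) (hhm : Measurable h) (hsm : Measurable s)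
    (h0 : ∀ y, 0 ≤ h y) (h1 : ∀ y, h y ≤ 1) (hs : ∀ y, |s y| = 1) (α : ℝ) :
    Integrable (fun y => deriv γ (log (1 - h y + exp (s y * α) * h y)) *
        (s y * (exp (s y * α) * h y / (1 - h y + exp (s y * α) * h y)))) ∧
    HasDerivAt (fun x => ∫ y, γ (log (1 - h y + exp (s y * x) * h y)))
      (∫ y, deriv γ (log (1 - h y + exp (s y * α) * h y)) *
        (s y * (exp (s y * α) * h y / (1 - h y + exp (s y * α) * h y)))) α := by
  set R : ℝ := |α| + 1
  have hdiff : Differentiable ℝ γ := hγ.differentiable one_ne_zero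
  have hcont : Continuous (deriv γ) := hγ.continuous_deriv le_rfl
  obtain ⟨C, hC⟩ := (isCompact_Icc (a := -R) (b := R)).exists_bound_of_continuousOn
    hcont.continuousOn
  have hbound : ∀ y, ∀ x ∈ Metric.ball (0 : ℝ) R,
      ‖deriv γ (log (1 - h y + exp (s y * x) * h y)) *
        (s y * (exp (s y * x) * h y / (1 - h y + exp (s y * x) * h y)))‖ ≤
      C * (exp (2 * R) * h y) := by
    intro y x hx
    have hu : |s y * x| ≤ R := by
      rw [abs_mul, hs, one_mul]
      simpa using (mem_ball_zero_iff.1 hx).le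
    have hlog := abs_le.1 ((abs_log_mix_le (h0 y) (h1 y) (s y * x)).trans hu)
    have hD := hC _ hlog
    rw [norm_mul, norm_mul, Real.norm_eq_abs (s y), hs, one_mul, Real.norm_of_nonneg
      (div_nonneg (mul_nonneg (exp_pos _).le (h0 y)) (mix_pos (h0 y) (h1 y) _).le)]
    refine mul_le_mul hD ((exp_mul_div_mix_le (h0 y) (h1 y) _).trans ?_)
      (div_nonneg (mul_nonneg (exp_pos _).le (h0 y)) (mix_pos (h0 y) (h1 y) _).le)
      ((norm_nonneg _).trans hD)
    gcongr
    exact h0 y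
  have hderiv := fun y x => hasDerivAt_comp_log_mix hdiff (h0 y) (h1 y) (s y) x
  have hα : α ∈ Metric.ball (0 : ℝ) R := by simp [R]
  have hmeas : ∀ x, AEStronglyMeasurable
      (fun y => γ (log (1 - h y + exp (s y * x) * h y))) volume := fun x =>
    (hγ.continuous.measurable.comp (by fun_prop)).aestronglyMeasurable
  have hbint : Integrable (fun y => C * (exp (2 * R) * h y)) := (hh.const_mul _).const_mul _
  refine hasDerivAt_integral_of_dominated_loc_of_deriv_le
    (F' := fun x y => deriv γ (log (1 - h y + exp (s y * x) * h y)) *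
        (s y * (exp (s y * x) * h y / (1 - h y + exp (s y * x) * h y))))
    (bound := fun y => C * (exp (2 * R) * h y))
    (Metric.isOpen_ball.mem_nhds hα) (.of_forall hmeas) ?_ ?_ (.of_forall hbound) hbint
    (.of_forall fun y x _ => hderiv y x)
  · refine (hbint.mul_const |α|).mono' (hmeas α) (.of_forall fun y => ?_)
    have := (convex_ball (0 : ℝ) R).norm_image_sub_le_of_norm_hasDerivWithin_le
      (fun x _ => (hderiv y x).hasDerivWithinAt) (hbound y)
      (Metric.mem_ball_self (by positivity)) hα
    simpa [hγ0] using this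
  · exact ((hcont.measurable.comp (by fun_prop)).mul (by fun_prop)).aestronglyMeasurable

lemma gPhi_eq_gaussianReal {v : NNReal} (hv : v ≠ 0) (y : ℝ) :
    gPhi v y = (gaussianReal 0 v).real (Set.Iic y) := by
  rw [measureReal_def, gaussianReal_apply_eq_integral 0 hv, ENNReal.toReal_ofReal
    (integral_nonneg fun x => gaussianPDFReal_nonneg 0 v x)]
  simp [gPhi, gphi, gaussianPDFReal]

lemma one_sub_gPhi_eq_gaussianReal {v : NNReal} (hv : v ≠ 0) (y : ℝ) :
    1 - gPhi v y = (gaussianReal 0 v).real (Set.Ioi y) := by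
  rw [gPhi_eq_gaussianReal hv, ← probReal_compl_eq_one_sub measurableSet_Iic, Set.compl_Iic]

lemma monotone_gPhi {v : NNReal} (hv : v ≠ 0) : Monotone (gPhi v) := fun a b hab => by
  rw [gPhi_eq_gaussianReal hv, gPhi_eq_gaussianReal hv]
  exact measureReal_mono (Set.Iic_subset_Iic.2 hab)

lemma integrableOn_gPhi {v : NNReal} (hv : v ≠ 0) : IntegrableOn (gPhi v) (Set.Iic 0) := by
  refine ((integrableOn_exp_Iic 0).mul_const (mgf id (gaussianReal 0 v) (-1))).mono'
    (monotone_gPhi hv).measurable.aestronglyMeasurable (.of_forall fun y => ?_)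
  rw [gPhi_eq_gaussianReal hv, Real.norm_of_nonneg measureReal_nonneg]
  simpa [Set.Iic] using measure_le_le_exp_mul_mgf (μ := gaussianReal 0 v) (X := id) y
    (by norm_num : (-1 : ℝ) ≤ 0) (integrable_exp_mul_gaussianReal _)

lemma integrableOn_one_sub_gPhi {v : NNReal} (hv : v ≠ 0) :
    IntegrableOn (fun y => 1 - gPhi v y) (Set.Ioi 0) := by
  refine ((integrableOn_exp_neg_Ioi 0).mul_const (mgf id (gaussianReal 0 v) 1)).mono'
    ((monotone_gPhi hv).measurable.const_sub 1).aestronglyMeasurable (.of_forall fun y => ?_)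
  rw [one_sub_gPhi_eq_gaussianReal hv, Real.norm_of_nonneg measureReal_nonneg]
  refine (measureReal_mono Set.Ioi_subset_Ici_self).trans ?_
  simpa [Set.Ici] using measure_ge_le_exp_mul_mgf (μ := gaussianReal 0 v) (X := id) y
    zero_le_one (integrable_exp_mul_gaussianReal _)

/-- `Λ` is differentiable with
`Λ′(α) = ∫_0^∞ γ′(Z_α(y))(1 − F_α(y)) dy − ∫_{−∞}^0 γ′(Z_α(y)) F_α(y) dy`. -/
theorem Lambda_deriv (t κ₂ : ℝ) (ht : 0 < t) (hκ : 0 < κ₂)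
    (Ω : Type) [MeasureSpace Ω] [IsProbabilityMeasure (volume : Measure Ω)]
    (η : Ω → ℝ) (hmeas : Measurable η) (hnonneg : ∀ ω, 0 ≤ η ω)
    (hint : ∀ θ : ℝ, Integrable (fun ω => Real.exp (θ * η ω)) volume)
    (γ : ℝ → ℝ) (hγ : ∀ θ, γ θ = Real.log (∫ ω, Real.exp (θ * η ω)))
    (Z : ℝ → ℝ → ℝ)
    (hZ : ∀ lam y, Z lam y =
      if 0 < y then Real.log (gPhi (κ₂ * t) y + Real.exp lam * (1 - gPhi (κ₂ * t) y))
      else Real.log (Real.exp (-lam) * gPhi (κ₂ * t) y + (1 - gPhi (κ₂ * t) y)))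
    (Λ : ℝ → ℝ) (hΛ : ∀ lam, Λ lam = ∫ y : ℝ, γ (Z lam y))
    (F : ℝ → ℝ → ℝ)
    (hF : ∀ α y, F α y = Real.exp (-α) * gPhi (κ₂ * t) y /
      (1 - gPhi (κ₂ * t) y + Real.exp (-α) * gPhi (κ₂ * t) y)) :
    ∀ α : ℝ, HasDerivAt Λ
      ((∫ y in Set.Ioi (0:ℝ), deriv γ (Z α y) * (1 - F α y))
        - ∫ y in Set.Iic (0:ℝ), deriv γ (Z α y) * F α y) α := by
  intro α
  obtain ⟨v, hv⟩ : ∃ v : NNReal, (v : ℝ) = κ₂ * t := ⟨⟨κ₂ * t, by positivity⟩, rfl⟩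
  have hv0 : v ≠ 0 := by
    rintro rfl
    exact (mul_pos hκ ht).ne hv
  rw [← hv] at hZ hF
  have hγ_eq : γ = cgf η volume := funext hγ
  have hγ_smooth : ContDiff ℝ 1 γ := by
    refine contDiff_iff_contDiffAt.2 fun θ => ?_
    rw [hγ_eq]
    refine (analyticAt_cgf ?_).contDiffAt
    have : integrableExpSet η volume = Set.univ := Set.eq_univ_of_forall hint
    simp [this]
  have hγ0 : γ 0 = 0 := by simp [hγ]
  have hΦ0 : ∀ y, 0 ≤ gPhi v y := fun y => by
    rw [gPhi_eq_gaussianReal hv0]; exact measureReal_nonneg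
  have hΦ1 : ∀ y, 0 ≤ 1 - gPhi v y := fun y => by
    rw [one_sub_gPhi_eq_gaussianReal hv0]; exact measureReal_nonneg
  have hΦm : Measurable (gPhi v) := (monotone_gPhi hv0).measurable
  let h : ℝ → ℝ := fun y => if 0 < y then 1 - gPhi v y else gPhi v y
  let s : ℝ → ℝ := fun y => if 0 < y then 1 else -1
  have hZ_eq : ∀ x y, Z x y = log (1 - h y + exp (s y * x) * h y) := by
    intro x y
    rw [hZ]
    by_cases hy : 0 < y
    · simp [h, s, hy]
    · simp only [h, s, hy, if_false, neg_one_mul]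
      rw [add_comm]
  have hpos : ∀ y, 0 < y → h y = 1 - gPhi v y ∧ s y = 1 := fun y hy => by simp [h, s, hy]
  have hneg : ∀ y, ¬ 0 < y → h y = gPhi v y ∧ s y = -1 := fun y hy => by simp [h, s, hy]
  have hh : Integrable h := by
    rw [← integrableOn_univ, ← Set.Iic_union_Ioi (a := (0 : ℝ))]
    refine ((integrableOn_gPhi hv0).congr_fun (fun y hy => ?_) measurableSet_Iic).union
      ((integrableOn_one_sub_gPhi hv0).congr_fun (fun y hy => ?_) measurableSet_Ioi)
    · exact (hneg y (not_lt.2 hy)).1.symm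
    · exact (hpos y hy).1.symm
  obtain ⟨hint', hder⟩ := hasDerivAt_integral_comp_log_mix (h := h) (s := s)
    hγ_smooth hγ0 hh
    (Measurable.ite measurableSet_Ioi (hΦm.const_sub 1) hΦm)
    (Measurable.ite measurableSet_Ioi measurable_const measurable_const)
    (fun y => by simp only [h]; split_ifs <;> linarith [hΦ0 y, hΦ1 y])
    (fun y => by simp only [h]; split_ifs <;> linarith [hΦ0 y, hΦ1 y])
    (fun y => by simp only [s]; split_ifs <;> simp) α
  simp only [← hZ_eq] at hint' hder
  rw [show Λ = fun x => ∫ y, γ (Z x y) from funext hΛ]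
  convert hder using 1
  rw [← integral_add_compl measurableSet_Ioi hint', Set.compl_Ioi, sub_eq_add_neg,
    ← integral_neg]
  congr 1
  · refine setIntegral_congr_fun measurableSet_Ioi fun y hy => ?_
    obtain ⟨e₁, e₂⟩ := hpos y hy
    have hw := mix_pos (h := gPhi v y) (hΦ0 y) (sub_nonneg.1 (hΦ1 y)) (-α)
    have hw' := mix_pos (h := 1 - gPhi v y) (hΦ1 y) (by linarith [hΦ0 y]) α
    simp only [e₁, e₂, one_mul, hF]
    congr 1
    rw [one_sub_div hw.ne', div_eq_div_iff hw.ne' hw'.ne']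
    have : exp α * exp (-α) = 1 := by rw [← exp_add]; simp
    linear_combination (-(1 - gPhi v y) * gPhi v y) * this
  · refine setIntegral_congr_fun measurableSet_Iic fun y hy => ?_
    obtain ⟨e₁, e₂⟩ := hneg y (not_lt.2 hy)
    simp only [e₁, e₂, neg_one_mul, hF, mul_neg]
end
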